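/- (Price of anarchy can be arbitrarily close to 2.) For every real δ > 0, there exist a finite connected simple graph G on a vertex set V, a finite resource set O with |O| ≥ 2, a pure Nash equilibrium P* of the CSR game on G, and an allocation Q : V → O, such that C(P*) ≥ (2 − δ)·C(Q). -/

import Mathlib

open Finset

noncomputable section

variable {V O : Type*} [Fintype V] [DecidableEq V] [Fintype O] [DecidableEq O]

/-- Diameter of the graph: maximum graph distance between any two vertices. -/
def csrDiam (G : SimpleGraph V) : ℕ :=
  Finset.sup Finset.univ fun i => Finset.sup Finset.univ fun j => G.dist i j

/-- Distance from player `i` to the nearest holder of resource `o` under allocation `P`;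
`csrDiam G + 1` if no one holds `o`. -/
def csrDist (G : SimpleGraph V) (P : V → O) (i : V) (o : O) : ℕ :=
  if h : (Finset.univ.filter fun j => P j = o).Nonempty then
    (Finset.univ.filter fun j => P j = o).inf' h fun j => G.dist i j
  else csrDiam G + 1

/-- Cost of player `i` under allocation `P`. -/
def csrCost (G : SimpleGraph V) (P : V → O) (i : V) : ℕ :=
  ∑ o ∈ Finset.univ.filter (fun o => o ≠ P i), csrDist G P i o

/-- Total cost of allocation `P`. -/
def csrTotal (G : SimpleGraph V) (P : V → O) : ℕ := ∑ i, csrCost G P i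

/-- Radius of player `i`: distance to nearest *other* player holding the same resource;
`csrDiam G` if there is none. -/
def csrRadius (G : SimpleGraph V) (P : V → O) (i : V) : ℕ :=
  if h : (Finset.univ.filter fun j => j ≠ i ∧ P j = P i).Nonempty then
    (Finset.univ.filter fun j => j ≠ i ∧ P j = P i).inf' h fun j => G.dist i j
  else csrDiam G

/-- Ball of radius `r` (a natural number) around `i`. -/
def csrBall (G : SimpleGraph V) (i : V) (r : ℕ) : Finset V :=
  Finset.univ.filter fun j => G.dist i j ≤ r

/-- Pure Nash equilibrium of the CSR game. -/
def csrIsNE (G : SimpleGraph V) (P : V → O) : Prop :=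
  ∀ (i : V) (o : O), csrCost G P i ≤ csrCost G (Function.update P i o) i

theorem csrDist_le_of (G : SimpleGraph V) (P : V → O) (i j : V) (o : O) (h : P j = o) :
    csrDist G P i o ≤ G.dist i j := by
  have hm : j ∈ Finset.univ.filter fun j => P j = o := by simp [h]
  have hn : (Finset.univ.filter fun j => P j = o).Nonempty := ⟨j, hm⟩
  rw [csrDist, dif_pos hn]
  exact Finset.inf'_le _ hm

theorem le_csrDist_of (G : SimpleGraph V) (P : V → O) (i : V) (o : O) (c : ℕ)
    (h : ∀ j, P j = o → c ≤ G.dist i j) (hc : c ≤ csrDiam G + 1) : c ≤ csrDist G P i o := by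
  rw [csrDist]
  split_ifs with hn
  · apply Finset.le_inf'
    intro j hj
    exact h j (by simpa using hj)
  · exact hc

theorem csrDiam_ge (G : SimpleGraph V) (i j : V) : G.dist i j ≤ csrDiam G :=
  (Finset.le_sup (f := fun j => G.dist i j) (Finset.mem_univ j)).trans
    (Finset.le_sup (f := fun i => Finset.sup Finset.univ fun j => G.dist i j) (Finset.mem_univ i))

theorem csrCost_update_ge (G : SimpleGraph V) (P : V → O) (i : V) (o : O)
    (h : o ≠ P i → csrDist G P i o ≤ csrDist G (Function.update P i o) i (P i)) :
    csrCost G P i ≤ csrCost G (Function.update P i o) i := by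
  by_cases ho : o = P i
  · subst ho; simp
  have h := h ho
  unfold csrCost
  rw [Function.update_self]
  have e1 : (Finset.univ.filter fun x => x ≠ P i)
      = insert o (Finset.univ.filter fun x => x ≠ P i ∧ x ≠ o) := by
    ext x; by_cases hx : x = o <;> simp [hx, ho]
  have e2 : (Finset.univ.filter fun x => x ≠ o)
      = insert (P i) (Finset.univ.filter fun x => x ≠ P i ∧ x ≠ o) := by
    ext x; by_cases hx : x = P i <;> simp [hx, Ne.symm ho]
  rw [e1, e2, Finset.sum_insert (by simp), Finset.sum_insert (by simp)]
  refine add_le_add h (le_of_eq (Finset.sum_congr rfl ?_))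
  intro x hx
  have hx : x ≠ P i ∧ x ≠ o := by simpa using hx
  have e : (Finset.univ.filter fun j => Function.update P i o j = x)
      = Finset.univ.filter fun j => P j = x := by
    ext j
    by_cases hj : j = i
    · subst hj; simp [hx.1.symm, hx.2.symm]
    · simp [hj]
  unfold csrDist
  simp only [e]

/-- Complete bipartite graph with parts `{i < a}` and `{a ≤ i}`. -/
def bipG (n a : ℕ) : SimpleGraph (Fin n) where
  Adj i j := (i.val < a ∧ a ≤ j.val) ∨ (j.val < a ∧ a ≤ i.val)
  symm := ⟨fun i j h => by tauto⟩
  loopless := ⟨fun i h => by omega⟩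

theorem bip_reach (n a : ℕ) (h0 : 0 < a) (ha : a < n) (i j : Fin n) :
    ∃ w : (bipG n a).Walk i j, w.length ≤ 2 := by
  by_cases h : (bipG n a).Adj i j
  · exact ⟨SimpleGraph.Walk.cons h SimpleGraph.Walk.nil, by simp⟩
  · have h' : ¬ ((i.val < a ∧ a ≤ j.val) ∨ (j.val < a ∧ a ≤ i.val)) := h
    by_cases hi : i.val < a
    · have h1 : (bipG n a).Adj i ⟨a, ha⟩ := Or.inl ⟨hi, le_refl a⟩
      have h2 : (bipG n a).Adj ⟨a, ha⟩ j := Or.inr ⟨by omega, le_refl a⟩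
      exact ⟨SimpleGraph.Walk.cons h1 (SimpleGraph.Walk.cons h2 SimpleGraph.Walk.nil), by simp⟩
    · have h1 : (bipG n a).Adj i ⟨0, by omega⟩ := Or.inr ⟨h0, by omega⟩
      have h2 : (bipG n a).Adj ⟨0, by omega⟩ j := Or.inl ⟨h0, by omega⟩
      exact ⟨SimpleGraph.Walk.cons h1 (SimpleGraph.Walk.cons h2 SimpleGraph.Walk.nil), by simp⟩

theorem bip_conn (n a : ℕ) (h0 : 0 < a) (ha : a < n) : (bipG n a).Connected := by
  haveI : Nonempty (Fin n) := ⟨⟨a, ha⟩⟩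
  exact ⟨fun i j => ⟨(bip_reach n a h0 ha i j).choose⟩⟩

theorem bip_dist_le (n a : ℕ) (h0 : 0 < a) (ha : a < n) (i j : Fin n) :
    (bipG n a).dist i j ≤ 2 := by
  obtain ⟨w, hw⟩ := bip_reach n a h0 ha i j
  exact (SimpleGraph.dist_le w).trans hw

theorem bip_dist_ge (n a : ℕ) (h0 : 0 < a) (ha : a < n) (i j : Fin n) (hne : i ≠ j)
    (h : ¬ (bipG n a).Adj i j) : 2 ≤ (bipG n a).dist i j := by
  have h1 := (bip_conn n a h0 ha).pos_dist_of_ne hne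
  have h2 : (bipG n a).dist i j ≠ 1 := fun e => h (SimpleGraph.dist_eq_one_iff_adj.1 e)
  omega

theorem bip_diam (n a : ℕ) (h0 : 0 < a) (ha : a < n) : 1 ≤ csrDiam (bipG n a) := by
  have h : (bipG n a).Adj ⟨0, by omega⟩ ⟨a, ha⟩ := Or.inl ⟨h0, le_refl a⟩
  have := csrDiam_ge (bipG n a) ⟨0, by omega⟩ ⟨a, ha⟩
  rwa [SimpleGraph.dist_eq_one_iff_adj.2 h] at this

/-- The bad equilibrium. -/
def badP (k n : ℕ) (i : Fin n) : Fin (k+2) :=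
  if i.val < k+2 then 0 else ⟨1 + i.val % (k+1), by
    have : i.val % (k+1) < k+1 := Nat.mod_lt _ (by omega)
    omega⟩

theorem badP_zero_iff (k n : ℕ) (i : Fin n) : badP k n i = 0 ↔ i.val < k+2 := by
  unfold badP
  split_ifs with h
  · simp [h]
  · simp [h, Fin.ext_iff]

theorem badP_surj (k n : ℕ) (hn : 3*k+5 ≤ n) (o : Fin (k+2)) : ∃ j, badP k n j = o := by
  by_cases ho : o = 0
  · exact ⟨⟨0, by omega⟩, by subst ho; simp [badP]⟩
  · have h1 : o.val ≠ 0 := fun e => ho (Fin.ext e)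
    have h2 := o.isLt
    refine ⟨⟨(o.val - 1) + (k+1)*2, by omega⟩, ?_⟩
    unfold badP
    rw [if_neg (by simp only; omega)]
    apply Fin.ext
    simp only [Nat.add_mul_mod_self_left]
    rw [Nat.mod_eq_of_lt (by omega)]
    omega

theorem bad_NE (k n : ℕ) (hn : 3*k+5 ≤ n) : csrIsNE (bipG n (k+2)) (badP k n) := by
  intro i o
  apply csrCost_update_ge
  intro ho
  obtain ⟨j, hj⟩ := badP_surj k n hn o
  refine ((csrDist_le_of _ _ i j o hj).trans
    (bip_dist_le n (k+2) (by omega) (by omega) i j)).trans ?_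
  apply le_csrDist_of
  · intro j hj
    by_cases hij : j = i
    · subst hij; simp at hj; exact absurd hj ho
    · rw [Function.update_of_ne hij] at hj
      apply bip_dist_ge n (k+2) (by omega) (by omega) i j (Ne.symm hij)
      intro h
      have h : (i.val < k+2 ∧ k+2 ≤ j.val) ∨ (j.val < k+2 ∧ k+2 ≤ i.val) := h
      have h1 := badP_zero_iff k n i
      have h2 := badP_zero_iff k n j
      rw [hj] at h2
      have := h1.symm.trans h2
      omega
  · have := bip_diam n (k+2) (by omega) (by omega)
    omega

theorem bad_cost (k n : ℕ) (hn : 3*k+5 ≤ n) (i : Fin n) (hi : k+2 ≤ i.val) :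
    2*k ≤ csrCost (bipG n (k+2)) (badP k n) i := by
  have hi0 : badP k n i ≠ 0 := by rw [Ne, badP_zero_iff]; omega
  unfold csrCost
  have hs : ({0, badP k n i}ᶜ : Finset (Fin (k+2)))
      ⊆ Finset.univ.filter fun o => o ≠ badP k n i := by
    intro x hx; simp at hx; simp [hx.2]
  refine le_trans ?_ (Finset.sum_le_sum_of_subset hs)
  have hcard : ({0, badP k n i}ᶜ : Finset (Fin (k+2))).card = k := by
    rw [Finset.card_compl, Finset.card_pair hi0.symm]; simp
  have := Finset.card_nsmul_le_sum ({0, badP k n i}ᶜ : Finset (Fin (k+2)))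
    (fun o => csrDist (bipG n (k+2)) (badP k n) i o) 2 ?_
  · rw [hcard] at this; simpa [mul_comm] using this
  · intro o ho
    have ho : o ≠ 0 ∧ o ≠ badP k n i := by simpa using ho
    apply le_csrDist_of
    · intro j hj
      apply bip_dist_ge n (k+2) (by omega) (by omega)
      · rintro rfl; exact ho.2 hj.symm
      · intro h
        have h : (i.val < k+2 ∧ k+2 ≤ j.val) ∨ (j.val < k+2 ∧ k+2 ≤ i.val) := h
        apply ho.1
        rw [← hj, badP_zero_iff]; omega
    · have := bip_diam n (k+2) (by omega) (by omega)
      omega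

theorem bad_total (k N : ℕ) (hn : 2*k+3 ≤ N) :
    N * (2*k) ≤ csrTotal (bipG (k+2+N) (k+2)) (badP k (k+2+N)) := by
  unfold csrTotal
  rw [Fin.sum_univ_add]
  refine le_trans ?_ (Nat.le_add_left _ _)
  have := Finset.card_nsmul_le_sum (Finset.univ : Finset (Fin N))
    (fun j => csrCost (bipG (k+2+N) (k+2)) (badP k (k+2+N)) (Fin.natAdd (k+2) j)) (2*k)
    (fun j _ => bad_cost k _ (by omega) _ (by simp))
  simpa using this

/-- The good allocation. -/
def goodQ (k n : ℕ) (i : Fin n) : Fin (k+2) := ⟨i.val % (k+2), Nat.mod_lt _ (by omega)⟩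

theorem good_total (k N : ℕ) (hn : k+2 ≤ N) :
    csrTotal (bipG (k+2+N) (k+2)) (goodQ k (k+2+N)) ≤ (k+2+N) * (k+1) := by
  unfold csrTotal
  have := Finset.sum_le_card_nsmul (Finset.univ : Finset (Fin (k+2+N)))
    (fun i => csrCost (bipG (k+2+N) (k+2)) (goodQ k (k+2+N)) i) (k+1) ?_
  · simpa using this
  intro i _
  have := Finset.sum_le_card_nsmul (Finset.univ.filter fun o => o ≠ goodQ k (k+2+N) i)
    (fun o => csrDist (bipG (k+2+N) (k+2)) (goodQ k (k+2+N)) i o) 1 ?_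
  · refine le_trans this ?_
    rw [Finset.filter_ne', Finset.card_erase_of_mem (Finset.mem_univ _)]
    simp
  intro o _
  have ho := o.isLt
  have key : ∃ j, goodQ k (k+2+N) j = o ∧ (bipG (k+2+N) (k+2)).Adj i j := by
    by_cases hi : i.val < k+2
    · refine ⟨⟨o.val + (k+2), by omega⟩, ?_, Or.inl ⟨hi, by simp⟩⟩
      apply Fin.ext
      simp [goodQ, Nat.mod_eq_of_lt ho]
    · refine ⟨⟨o.val, by omega⟩, ?_, Or.inr ⟨ho, by omega⟩⟩
      apply Fin.ext
      simp [goodQ, Nat.mod_eq_of_lt ho]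
  obtain ⟨j, hj, ha⟩ := key
  refine (csrDist_le_of _ _ i j o hj).trans ?_
  rw [SimpleGraph.dist_eq_one_iff_adj.2 ha]

/-- The price of anarchy can be arbitrarily close to 2: for every `δ > 0`
there are a connected graph, a resource set with `|O| ≥ 2`, a pure Nash equilibrium `P*`
and an allocation `Q` with `C(P*) ≥ (2 - δ) C(Q)`. -/
theorem stmt6 (δ : ℝ) (hδ : 0 < δ) :
    ∃ (n m : ℕ) (G : SimpleGraph (Fin n)) (Pstar Q : Fin n → Fin m),
      G.Connected ∧ 2 ≤ m ∧ csrIsNE G Pstar ∧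
      (2 - δ) * (csrTotal G Q : ℝ) ≤ (csrTotal G Pstar : ℝ) := by
  obtain ⟨k, hk⟩ := exists_nat_gt (4 / δ)
  have hk' : 4 < k * δ := by rwa [div_lt_iff₀ hδ] at hk
  set N := (k+2)*(k+2) with hN
  have hN1 : 2*k+3 ≤ N := by nlinarith
  refine ⟨k+2+N, k+2, bipG _ (k+2), badP k _, goodQ k _,
    bip_conn _ _ (by omega) (by omega), by omega, bad_NE k _ (by omega), ?_⟩
  have h1 := bad_total k N hN1
  have h2 := good_total k N (by omega)
  generalize csrTotal (bipG (k+2+N) (k+2)) (badP k (k+2+N)) = A at *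
  generalize csrTotal (bipG (k+2+N) (k+2)) (goodQ k (k+2+N)) = B at *
  have h1' : ((k:ℝ)+2)*(k+2)*(2*k) ≤ A := by rw [hN] at h1; exact_mod_cast h1
  have h2' : (B:ℝ) ≤ ((k:ℝ)+2+(k+2)*(k+2))*(k+1) := by rw [hN] at h2; exact_mod_cast h2
  have hB : (0:ℝ) ≤ B := Nat.cast_nonneg _
  have hk0 : (0:ℝ) ≤ k := Nat.cast_nonneg _
  rcases le_total (2 - δ) 0 with hd | hd
  · have : (2-δ) * (B:ℝ) ≤ 0 := mul_nonpos_of_nonpos_of_nonneg hd hB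
    have : (0:ℝ) ≤ A := Nat.cast_nonneg _
    linarith
  · refine (mul_le_mul_of_nonneg_left h2' hd).trans (le_trans ?_ h1')
    have : (2-δ) * (((k:ℝ)+3)*(k+1)) ≤ (k+2)*(2*k) := by nlinarith
    have := mul_le_mul_of_nonneg_left this (by linarith : (0:ℝ) ≤ (k:ℝ)+2)
    nlinarith
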